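/- (Selection lemma.) Let P be a set of n points in ℝ^d with Δ = diam(P), let ε ∈ (0,1) be a parameter, and let r = ⌈2/ε²⌉. Then at least n^r/2 of the sequences Q = (q_1, …, q_r) ∈ P^r satisfy ‖(1/r)·∑_{i=1}^r q_i − c(P)‖ ≤ ε·Δ; in particular, the closed ball of radius ε·Δ centered at c(P) intersects the convex hull of at least n^r/2 of the sequences in P^r. -/

import Mathlib

open Finset
open scoped Classical

/-- The centroid of a finite set of points in `ℝ^d`. -/
noncomputable def centroid {d : ℕ} (P : Finset (EuclideanSpace ℝ (Fin d))) :
    EuclideanSpace ℝ (Fin d) :=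
  (P.card : ℝ)⁻¹ • ∑ p ∈ P, p

/-- Summing over sequences of length `r + 1` amounts to summing over the first term and the
remaining `r` terms. -/
lemma sum_piFinset_const_succ {α M : Type*} [AddCommMonoid M] (P : Finset α) (r : ℕ)
    (g : (Fin (r + 1) → α) → M) :
    ∑ q ∈ Fintype.piFinset (fun _ : Fin (r + 1) => P), g q =
      ∑ p ∈ P, ∑ q ∈ Fintype.piFinset (fun _ : Fin r => P), g (Fin.cons p q) := by
  rw [← Finset.sum_product']
  symm
  refine Finset.sum_equiv (Fin.consEquiv fun _ => α) (fun x => ?_) (fun x _ => rfl)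
  simp [Fin.forall_fin_succ]

section SecondMoment

variable {α E : Type*} [NormedAddCommGroup E] [InnerProductSpace ℝ E]

lemma sum_norm_add_sq_of_sum_eq_zero (P : Finset α) (f : α → E) (hf : ∑ p ∈ P, f p = 0) (x : E) :
    ∑ p ∈ P, ‖f p + x‖ ^ 2 = ∑ p ∈ P, ‖f p‖ ^ 2 + P.card * ‖x‖ ^ 2 := by
  have h : ∑ p ∈ P, inner ℝ (f p) x = 0 := by rw [← sum_inner, hf, inner_zero_left]
  simp [norm_add_sq_real, Finset.sum_add_distrib, ← Finset.mul_sum, h]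

/-- The second moment of a sum of `r` independent centered vectors is at most `r` times the
bound on the individual second moments. -/
lemma sum_piFinset_norm_sum_sq_le (P : Finset α) (f : α → E) (hf : ∑ p ∈ P, f p = 0) {M : ℝ}
    (hM : ∑ p ∈ P, ‖f p‖ ^ 2 ≤ P.card * M) (r : ℕ) :
    ∑ q ∈ Fintype.piFinset (fun _ : Fin r => P), ‖∑ i, f (q i)‖ ^ 2 ≤
      r * (P.card : ℝ) ^ r * M := by
  induction r with
  | zero => simp
  | succ r ih =>
    rw [sum_piFinset_const_succ, Finset.sum_comm]
    simp only [Fin.sum_univ_succ, Fin.cons_zero, Fin.cons_succ,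
      sum_norm_add_sq_of_sum_eq_zero P f hf, Finset.sum_add_distrib, ← Finset.mul_sum,
      Finset.sum_const, Fintype.card_piFinset, Finset.prod_const, Finset.card_univ,
      Fintype.card_fin, nsmul_eq_mul]
    push_cast
    calc _ ≤ (P.card : ℝ) ^ r * (P.card * M) + P.card * (r * (P.card : ℝ) ^ r * M) := by gcongr
      _ = _ := by ring

/-- Chebyshev's inequality for averages of `r` independent centered vectors of norm at most `D`. -/
lemma half_card_pow_le_card_filter_norm_sum_le (P : Finset α) (f : α → E)
    (hf : ∑ p ∈ P, f p = 0) {D ε : ℝ} (hD : ∀ p ∈ P, ‖f p‖ ≤ D) (hD0 : 0 ≤ D) (hε : 0 < ε)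
    {r : ℕ} (hr : 2 ≤ r * ε ^ 2) :
    (P.card : ℝ) ^ r / 2 ≤ (((Fintype.piFinset (fun _ : Fin r => P)).filter
      (fun q => ‖∑ i, f (q i)‖ ≤ r * (ε * D))).card : ℝ) := by
  set S := Fintype.piFinset (fun _ : Fin r => P)
  have hS : (S.card : ℝ) = (P.card : ℝ) ^ r := by simp [S]
  have hsplit : ((S.filter fun q => ‖∑ i, f (q i)‖ ≤ r * (ε * D)).card : ℝ) +
      (S.filter fun q => ¬ ‖∑ i, f (q i)‖ ≤ r * (ε * D)).card = S.card := by
    exact_mod_cast Finset.card_filter_add_card_filter_not _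
  set B := S.filter fun q => ¬ ‖∑ i, f (q i)‖ ≤ r * (ε * D)
  suffices hB : (B.card : ℝ) ≤ (P.card : ℝ) ^ r / 2 by linarith
  rcases hD0.eq_or_lt with rfl | hDpos
  · have hB : B = ∅ := by
      refine Finset.filter_eq_empty_iff.mpr fun q hq => not_not.mpr ?_
      have hzero : ∀ i, f (q i) = 0 := fun i =>
        norm_le_zero_iff.mp (hD _ (Fintype.mem_piFinset.mp hq i))
      simp [hzero]
    rw [hB]
    simp only [Finset.card_empty, Nat.cast_zero]
    positivity
  · have hM : ∑ p ∈ P, ‖f p‖ ^ 2 ≤ P.card * D ^ 2 := by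
      rw [← nsmul_eq_mul]
      exact Finset.sum_le_card_nsmul _ _ _ fun p hp => by gcongr; exact hD p hp
    have hlower : B.card * (r * (ε * D)) ^ 2 ≤ ∑ q ∈ S, ‖∑ i, f (q i)‖ ^ 2 := by
      rw [← nsmul_eq_mul]
      refine (Finset.card_nsmul_le_sum B _ _ fun q hq => ?_).trans
        (Finset.sum_le_sum_of_subset_of_nonneg (Finset.filter_subset _ _)
          fun _ _ _ => by positivity)
      have := (not_le.mp (Finset.mem_filter.mp hq).2).le
      gcongr
    have hupper := hlower.trans (sum_piFinset_norm_sum_sq_le P f hf hM r)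
    have hrpos : (0 : ℝ) < r := by
      by_contra! h
      nlinarith [sq_nonneg ε]
    have hcancel : B.card * (r * ε ^ 2) ≤ (P.card : ℝ) ^ r := by
      refine le_of_mul_le_mul_right (a := r * D ^ 2) ?_ (by positivity)
      linarith
    have : (B.card : ℝ) * 2 ≤ B.card * (r * ε ^ 2) := by gcongr
    linarith

end SecondMoment

lemma centroid_mem_convexHull {d : ℕ} {P : Finset (EuclideanSpace ℝ (Fin d))}
    (hP : P.Nonempty) : _root_.centroid P ∈ convexHull ℝ (P : Set (EuclideanSpace ℝ (Fin d))) := by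
  have hcard : (P.card : ℝ) ≠ 0 := by exact_mod_cast hP.card_ne_zero
  rw [_root_.centroid, Finset.smul_sum]
  exact (convex_convexHull ℝ _).sum_mem (fun _ _ => by positivity) (by simp [hcard])
    fun p hp => subset_convexHull ℝ _ hp

lemma norm_sub_centroid_le_diam {d : ℕ} {P : Finset (EuclideanSpace ℝ (Fin d))}
    {p : EuclideanSpace ℝ (Fin d)} (hp : p ∈ P) :
    ‖p - _root_.centroid P‖ ≤ Metric.diam (P : Set (EuclideanSpace ℝ (Fin d))) := by
  rw [← dist_eq_norm, ← convexHull_diam]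
  exact Metric.dist_le_diam_of_mem (isBounded_convexHull.mpr P.finite_toSet.isBounded)
    (subset_convexHull ℝ _ hp) (centroid_mem_convexHull ⟨p, hp⟩)

lemma sum_sub_centroid {d : ℕ} (P : Finset (EuclideanSpace ℝ (Fin d))) :
    ∑ p ∈ P, (p - _root_.centroid P) = 0 := by
  rcases P.eq_empty_or_nonempty with rfl | hP
  · simp
  · have hcard : (P.card : ℝ) ≠ 0 := by exact_mod_cast hP.card_ne_zero
    rw [Finset.sum_sub_distrib, Finset.sum_const, ← Nat.cast_smul_eq_nsmul ℝ, _root_.centroid,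
      smul_inv_smul₀ hcard, sub_self]

/-- Selection lemma: for `r = ⌈2/ε²⌉`, at least `n^r/2` of the sequences in `P^r` have
their average within distance `ε · diam(P)` of `c(P)`; in particular the closed ball of
radius `ε · diam(P)` centered at `c(P)` intersects the convex hulls of at least `n^r/2`
of the sequences in `P^r`. -/
theorem selection_lemma {d : ℕ} (P : Finset (EuclideanSpace ℝ (Fin d)))
    (n r : ℕ) (ε Δ : ℝ) (hn : P.card = n)
    (hΔ : Δ = Metric.diam (P : Set (EuclideanSpace ℝ (Fin d))))
    (hε : ε ∈ Set.Ioo (0 : ℝ) 1) (hr : r = ⌈2 / ε ^ 2⌉₊) :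
    (n : ℝ) ^ r / 2 ≤
      (((Fintype.piFinset (fun _ : Fin r => P)).filter
        (fun q => ‖((r : ℝ)⁻¹ • ∑ i : Fin r, q i) - centroid P‖ ≤ ε * Δ)).card : ℝ) ∧
    (n : ℝ) ^ r / 2 ≤
      (((Fintype.piFinset (fun _ : Fin r => P)).filter
        (fun q => (Metric.closedBall (centroid P) (ε * Δ) ∩
          convexHull ℝ (Set.range q)).Nonempty)).card : ℝ) := by
  have hεpos := hε.1
  have hrε : 2 ≤ r * ε ^ 2 := by
    rw [← div_le_iff₀ (by positivity), hr]
    exact Nat.le_ceil _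
  have hr0 : (0 : ℝ) < r := by
    rw [hr]
    exact_mod_cast Nat.ceil_pos.mpr (by positivity)
  have havg : (n : ℝ) ^ r / 2 ≤ (((Fintype.piFinset (fun _ : Fin r => P)).filter
      (fun q => ‖((r : ℝ)⁻¹ • ∑ i : Fin r, q i) - _root_.centroid P‖ ≤ ε * Δ)).card : ℝ) := by
    rw [← hn, hΔ]
    refine (half_card_pow_le_card_filter_norm_sum_le P (fun p => p - _root_.centroid P)
      (sum_sub_centroid P) (fun p hp => norm_sub_centroid_le_diam hp) Metric.diam_nonneg
      hεpos hrε).trans ?_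
    refine Nat.cast_le.mpr (Finset.card_le_card (Finset.monotone_filter_right _ fun q _ h => ?_))
    have hscale : ((r : ℝ)⁻¹ • ∑ i, q i) - _root_.centroid P =
        (r : ℝ)⁻¹ • ∑ i, (q i - _root_.centroid P) := by
      rw [Finset.sum_sub_distrib, Finset.sum_const, Finset.card_univ, Fintype.card_fin,
        ← Nat.cast_smul_eq_nsmul ℝ, smul_sub, inv_smul_smul₀ hr0.ne']
    rw [hscale, norm_smul, norm_inv, Real.norm_natCast, inv_mul_le_iff₀ hr0]
    exact h
  refine ⟨havg, havg.trans ?_⟩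
  gcongr with q
  intro h
  refine ⟨_, mem_closedBall_iff_norm.mpr h, ?_⟩
  rw [Finset.smul_sum]
  exact (convex_convexHull ℝ _).sum_mem (fun _ _ => by positivity) (by simp [hr0.ne'])
    fun i _ => subset_convexHull ℝ _ ⟨i, rfl⟩
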